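/- Let ξ be a norm on ℝ^N that is differentiable on ℝ^N∖{0} and whose dual norm ξ⁰(x) := sup{x·x' : ξ(x') ≤ 1} is also differentiable on ℝ^N∖{0}. Then for every x ≠ 0: ξ(∇ξ⁰(x)) = 1, ξ⁰(x)·∇ξ(∇ξ⁰(x)) = x, and the divergence of the vector field x ↦ x/ξ⁰(x) equals (N−1)/ξ⁰(x). -/

import Mathlib

open Set RealInnerProductSpace

/-- Divergence of a vector field on `ℝ^N`. -/
noncomputable def diverg {N : ℕ}
    (V : EuclideanSpace ℝ (Fin N) → EuclideanSpace ℝ (Fin N))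
    (x : EuclideanSpace ℝ (Fin N)) : ℝ :=
  ∑ i : Fin N, ⟪fderiv ℝ V x (EuclideanSpace.single i 1), EuclideanSpace.single i (1 : ℝ)⟫

/-- A norm on `ℝ^N`: convex, positively 1-homogeneous, symmetric and positive away
from the origin. -/
def IsNormE {N : ℕ} (ξ : EuclideanSpace ℝ (Fin N) → ℝ) : Prop :=
  ConvexOn ℝ Set.univ ξ ∧ (∀ c : ℝ, 0 < c → ∀ p, ξ (c • p) = c * ξ p) ∧
    (∀ p, ξ (-p) = ξ p) ∧ (∀ p, p ≠ 0 → 0 < ξ p)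

/-- Dual norm `ξ⁰(x) = sup {x·x' : ξ(x') ≤ 1}` on `ℝ^N`. -/
noncomputable def dualNormE {N : ℕ} (ξ : EuclideanSpace ℝ (Fin N) → ℝ)
    (x : EuclideanSpace ℝ (Fin N)) : ℝ :=
  sSup ((fun p => ⟪x, p⟫) '' {p | ξ p ≤ 1})

theorem grad_eq_of_touch {N : ℕ} (f : EuclideanSpace ℝ (Fin N) → ℝ)
    (x p : EuclideanSpace ℝ (Fin N)) (hf : DifferentiableAt ℝ f x)
    (hle : ∀ y, ⟪p, y⟫ ≤ f y) (heq : ⟪p, x⟫ = f x) : gradient f x = p := by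
  have h1 : HasFDerivAt (fun y => f y - innerSL ℝ p y) (fderiv ℝ f x - innerSL ℝ p) x :=
    hf.hasFDerivAt.sub (innerSL ℝ p).hasFDerivAt
  have h2 : IsLocalMin (fun y => f y - innerSL ℝ p y) x := by
    refine Filter.Eventually.of_forall fun y => ?_
    have := hle y
    simp only [innerSL_apply_apply]
    linarith
  have h3 := sub_eq_zero.1 (h2.hasFDerivAt_eq_zero h1)
  apply HasGradientAt.gradient
  rw [hasGradientAt_iff_hasFDerivAt]
  have h4 := hf.hasFDerivAt
  rw [h3] at h4
  exact h4

theorem isCompact_ball {N : ℕ} (ξ : EuclideanSpace ℝ (Fin N) → ℝ) (hξ : IsNormE ξ) :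
    IsCompact {p | ξ p ≤ 1} := by
  obtain ⟨hc, hh, hs, hp⟩ := hξ
  have hcont : Continuous ξ := by
    rw [← continuousOn_univ]
    exact hc.continuousOn isOpen_univ
  have h0 : ξ 0 = 0 := by
    have := hh 2 two_pos 0
    rw [smul_zero] at this
    linarith
  apply Metric.isCompact_of_isClosed_isBounded (isClosed_le hcont continuous_const)
  by_cases hne : (Metric.sphere (0 : EuclideanSpace ℝ (Fin N)) 1).Nonempty
  · obtain ⟨m, hm, hmin⟩ := (isCompact_sphere (0 : EuclideanSpace ℝ (Fin N)) 1).exists_isMinOn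
      hne hcont.continuousOn
    have hm0 : 0 < ξ m := hp m (by rintro rfl; simp at hm)
    refine (Metric.isBounded_closedBall (x := (0 : EuclideanSpace ℝ (Fin N)))
      (r := (ξ m)⁻¹)).subset fun p hp1 => ?_
    rw [mem_closedBall_zero_iff]
    by_cases hp0 : p = 0
    · simp [hp0, hm0.le]
    have hn : 0 < ‖p‖ := norm_pos_iff.2 hp0
    have h1 : ξ m ≤ ξ (‖p‖⁻¹ • p) := hmin (by simp [norm_smul, hn.ne'])
    rw [hh _ (inv_pos.2 hn)] at h1
    rw [le_inv_comm₀ hn hm0]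
    refine h1.trans ?_
    exact mul_le_of_le_one_right (inv_pos.2 hn).le hp1
  · refine (Metric.isBounded_closedBall (x := (0 : EuclideanSpace ℝ (Fin N)))
      (r := 0)).subset fun p hp1 => ?_
    rw [mem_closedBall_zero_iff]
    by_contra hn
    push Not at hn
    exact hne ⟨‖p‖⁻¹ • p, by simp [norm_smul, hn.ne']⟩

theorem stmt18 (N : ℕ)
    (ξ : EuclideanSpace ℝ (Fin N) → ℝ) (hξ : IsNormE ξ)
    (hξdiff : DifferentiableOn ℝ ξ {(0 : EuclideanSpace ℝ (Fin N))}ᶜ)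
    (hξ0diff : DifferentiableOn ℝ (dualNormE ξ) {(0 : EuclideanSpace ℝ (Fin N))}ᶜ) :
    ∀ x : EuclideanSpace ℝ (Fin N), x ≠ 0 →
      ξ (gradient (dualNormE ξ) x) = 1 ∧
      dualNormE ξ x • gradient ξ (gradient (dualNormE ξ) x) = x ∧
      diverg (fun y => (dualNormE ξ y)⁻¹ • y) x = ((N : ℝ) - 1) / dualNormE ξ x := by
  intro x hx
  have hK := isCompact_ball ξ hξ
  obtain ⟨hc, hh, hs, hp⟩ := hξ
  have h0 : ξ 0 = 0 := by
    have := hh 2 two_pos 0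
    rw [smul_zero] at this
    linarith
  have hcomp : ∀ y : EuclideanSpace ℝ (Fin N),
      IsCompact ((fun p => ⟪y, p⟫) '' {p | ξ p ≤ 1}) := fun y =>
    hK.image (by fun_prop)
  have hle1 : ∀ y p : EuclideanSpace ℝ (Fin N), ξ p ≤ 1 → ⟪y, p⟫ ≤ dualNormE ξ y :=
    fun y p h => le_csSup (hcomp y).bddAbove ⟨p, h, rfl⟩
  have hle : ∀ y p : EuclideanSpace ℝ (Fin N), ⟪y, p⟫ ≤ dualNormE ξ y * ξ p := by
    intro y p
    by_cases hp0 : p = 0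
    · simp [hp0, h0]
    have h1 := hp p hp0
    have h2 := hle1 y ((ξ p)⁻¹ • p) (by rw [hh _ (inv_pos.2 h1), inv_mul_cancel₀ h1.ne'])
    rw [real_inner_smul_right, inv_mul_le_iff₀ h1] at h2
    linarith
  have hpos : 0 < dualNormE ξ x := by
    have h1 := hle x x
    have h2 : 0 < ⟪x, x⟫ := real_inner_self_pos.2 hx
    exact pos_of_mul_pos_left (h2.trans_le h1) (hp x hx).le
  have hnhds : ∀ y : EuclideanSpace ℝ (Fin N), y ≠ 0 →
      ({(0 : EuclideanSpace ℝ (Fin N))}ᶜ : Set _) ∈ nhds y := fun y hy =>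
    isOpen_compl_singleton.mem_nhds hy
  have hd0 := hξ0diff.differentiableAt (hnhds x hx)
  obtain ⟨p, hp1, hpe⟩ := (hcomp x).sSup_mem ⟨_, 0, by simp [h0], rfl⟩
  change ⟪x, p⟫ = dualNormE ξ x at hpe
  have hg : gradient (dualNormE ξ) x = p := by
    apply grad_eq_of_touch _ _ _ hd0
    · intro y
      rw [real_inner_comm]
      exact hle1 y p hp1
    · rw [real_inner_comm, hpe]
  have hξp : ξ p = 1 := by
    apply le_antisymm hp1
    have := hle x p
    rw [hpe] at this
    exact (le_mul_iff_one_le_right hpos).1 this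
  have hpne : p ≠ 0 := by
    rintro rfl
    rw [h0] at hξp
    exact zero_ne_one hξp
  rw [hg]
  refine ⟨hξp, ?_, ?_⟩
  · have : gradient ξ p = (dualNormE ξ x)⁻¹ • x := by
      apply grad_eq_of_touch _ _ _ (hξdiff.differentiableAt (hnhds p hpne))
      · intro y
        rw [real_inner_smul_left, inv_mul_le_iff₀ hpos]
        exact hle x y
      · rw [real_inner_smul_left, hpe, hξp, inv_mul_cancel₀ hpos.ne']
    rw [this, smul_inv_smul₀ hpos.ne']
  · have hgr : HasFDerivAt (dualNormE ξ) (innerSL ℝ p) x := by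
      have := hd0.hasGradientAt
      rw [hg, hasGradientAt_iff_hasFDerivAt] at this
      exact this
    have hinv := (hasDerivAt_inv hpos.ne').comp_hasFDerivAt x hgr
    have hF := hinv.smul (hasFDerivAt_id x)
    have hF' : fderiv ℝ (fun y => (dualNormE ξ y)⁻¹ • y) x = _ := hF.fderiv
    have hsum : ∑ i, p i * x i = dualNormE ξ x := by
      rw [← hpe]
      simp [PiLp.inner_apply]
    unfold diverg
    rw [hF']
    have : ∀ i : Fin N, ⟪((dualNormE ξ x)⁻¹ • ContinuousLinearMap.id ℝ (EuclideanSpace ℝ (Fin N)) +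
        (-(dualNormE ξ x ^ 2)⁻¹ • innerSL ℝ p).smulRight x) (EuclideanSpace.single i 1),
        EuclideanSpace.single i (1 : ℝ)⟫ =
        (dualNormE ξ x)⁻¹ - (dualNormE ξ x ^ 2)⁻¹ * (p i * x i) := by
      intro i
      simp [inner_add_left, real_inner_smul_left, EuclideanSpace.inner_single_right]
      ring
    refine (Finset.sum_congr rfl fun i _ => this i).trans ?_
    rw [Finset.sum_sub_distrib, ← Finset.mul_sum, hsum]
    simp
    field_simp
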